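/- arXiv:1609.03465 — 2 statements merged into one kernel-verified Lean document; each statement's English description precedes it below -/
import Mathlib

section
/- Under Assumption 2, the matrix I − ΞW is invertible and for every x0 ∈ ℝⁿ the F-J iteration x(0) = x0, x(k+1) = ΞW·x(k) + (I − Ξ)·x0 converges entrywise, as k → ∞, to (I − ΞW)⁻¹(I − Ξ)·x0. -/
open Matrix Filter Finset

/-- The Friedkin–Johnsen iteration: `x 0 = x0`, `x (k+1) = A ⬝ x k + B ⬝ x0`. -/
noncomputable def fjSeq {n : ℕ} (A B : Matrix (Fin n) (Fin n) ℝ) (x0 : Fin n → ℝ) :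
    ℕ → Fin n → ℝ
  | 0 => x0
  | k + 1 => A.mulVec (fjSeq A B x0 k) + B.mulVec x0

/-- `S` is an independent strongly connected component of the influence graph `G(W)`
(edge from `j` to `i` iff `W i j ≠ 0`): nonempty, in-closed and strongly connected. -/
def IsISCC {n : ℕ} (W : Matrix (Fin n) (Fin n) ℝ) (S : Set (Fin n)) : Prop :=
  S.Nonempty ∧ (∀ i ∈ S, ∀ j, W i j ≠ 0 → j ∈ S) ∧
    (∀ i ∈ S, ∀ j ∈ S, i ≠ j → ∃ m, 1 ≤ m ∧ 0 < (W ^ m) i j)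

/-- Assumption 2: every ISCC of `G(W)` contains at least one stubborn agent. -/
def Assumption2 {n : ℕ} (W : Matrix (Fin n) (Fin n) ℝ) (ξ : Fin n → ℝ) : Prop :=
  ∀ S : Set (Fin n), IsISCC W S → ∃ i ∈ S, ξ i < 1

/-- A nonempty in-closed set of vertices contains an independent strongly connected component. -/
theorem exists_isISCC_subset {n : ℕ} {W : Matrix (Fin n) (Fin n) ℝ} (hW : ∀ i j, 0 ≤ W i j)
    {S : Set (Fin n)} (hS : S.Nonempty) (hcl : ∀ i ∈ S, ∀ j, W i j ≠ 0 → j ∈ S) :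
    ∃ T ⊆ S, IsISCC W T := by
  obtain ⟨T, hTS, hT⟩ := (Set.toFinite
    {T : Set (Fin n) | T.Nonempty ∧ ∀ i ∈ T, ∀ j, W i j ≠ 0 → j ∈ T}).exists_le_minimal ⟨hS, hcl⟩
  refine ⟨T, hTS, hT.prop.1, hT.prop.2, fun i hi j hj hij => ?_⟩
  have hreach : ∀ m k, 0 < (W ^ m) i k → k ∈ T := by
    intro m
    induction m with
    | zero =>
      intro k hk
      rw [pow_zero, Matrix.one_apply] at hk
      split_ifs at hk with h
      · exact h ▸ hi
      · exact absurd hk (lt_irrefl 0)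
    | succ m ih =>
      intro k hk
      rw [pow_succ, Matrix.mul_apply] at hk
      obtain ⟨l, -, hl⟩ := Finset.exists_ne_zero_of_sum_ne_zero hk.ne'
      exact hT.prop.2 l (ih l ((Matrix.pow_apply_nonneg hW m i l).lt_of_ne'
        (left_ne_zero_of_mul hl))) k (right_ne_zero_of_mul hl)
  have hle : T ⊆ {k | ∃ m, 0 < (W ^ m) i k} := by
    refine hT.le_of_le ⟨⟨i, 0, by simp⟩, ?_⟩ fun k ⟨m, hm⟩ => hreach m k hm
    rintro k ⟨m, hm⟩ l hkl
    refine ⟨m + 1, ?_⟩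
    rw [pow_succ, Matrix.mul_apply]
    exact Finset.sum_pos' (fun a _ => mul_nonneg (Matrix.pow_apply_nonneg hW m i a) (hW a l))
      ⟨k, Finset.mem_univ k, mul_pos hm ((hW k l).lt_of_ne' hkl)⟩
  obtain ⟨m, hm⟩ := hle hj
  refine ⟨m, Nat.one_le_iff_ne_zero.2 ?_, hm⟩
  rintro rfl
  simp [Matrix.one_apply_ne hij] at hm

/-- Under Assumption 2, the only nonnegative fixed vector of `ΞW` is zero. -/
theorem eq_zero_of_diagonal_mul_mulVec_eq {n : ℕ} {W : Matrix (Fin n) (Fin n) ℝ} {ξ : Fin n → ℝ}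
    (hW0 : ∀ i j, 0 ≤ W i j) (hW1 : ∀ i, ∑ j, W i j = 1) (hξ : ∀ i, 0 ≤ ξ i ∧ ξ i ≤ 1)
    (hA2 : Assumption2 W ξ) {v : Fin n → ℝ} (hv0 : ∀ i, 0 ≤ v i)
    (hv : (Matrix.diagonal ξ * W).mulVec v = v) : v = 0 := by
  by_contra hne
  obtain ⟨a, ha⟩ := Function.ne_iff.1 hne
  obtain ⟨b, -, hb⟩ := Finset.exists_max_image Finset.univ v ⟨a, Finset.mem_univ a⟩
  have hmax : ∀ i, v i ≤ v b := fun i => hb i (Finset.mem_univ i)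
  have hpos : 0 < v b := ((hv0 a).lt_of_ne' ha).trans_le (hmax a)
  have hfix : ∀ i, ξ i * ∑ j, W i j * v j = v i := fun i => by
    have h := congrFun hv i
    rwa [← Matrix.mulVec_mulVec, Matrix.mulVec_diagonal] at h
  have hterm : ∀ i j, W i j * v j ≤ W i j * v b := fun i j =>
    mul_le_mul_of_nonneg_left (hmax j) (hW0 i j)
  have hconst : ∀ i, ∑ j, W i j * v b = v b := fun i => by
    rw [← Finset.sum_mul, hW1, one_mul]
  have havg : ∀ i, ∑ j, W i j * v j ≤ v b := fun i =>
    (Finset.sum_le_sum fun j _ => hterm i j).trans_eq (hconst i)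
  have hstub : ∀ i, v i = v b → ξ i = 1 := fun i hi => by
    have h := mul_le_mul_of_nonneg_left (havg i) (hξ i).1
    rw [hfix, hi] at h
    nlinarith [(hξ i).2]
  have hcl : ∀ i ∈ {i | v i = v b}, ∀ j, W i j ≠ 0 → j ∈ {i | v i = v b} := by
    intro i hi j hij
    have h := hfix i
    rw [hstub i hi, one_mul, hi.out, ← hconst i,
      Finset.sum_eq_sum_iff_of_le fun j _ => hterm i j] at h
    exact mul_left_cancel₀ hij (h j (Finset.mem_univ j))
  obtain ⟨T, hTS, hT⟩ := exists_isISCC_subset (S := {i | v i = v b}) hW0 ⟨b, rfl⟩ hcl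
  obtain ⟨i, hi, hlt⟩ := hA2 T hT
  exact hlt.ne (hstub i (hTS hi))

/-- If a nonnegative matrix has row sums at most one and no nonzero nonnegative fixed vector,
then its powers tend to zero. -/
theorem tendsto_pow_mulVec_zero {n : ℕ} {A : Matrix (Fin n) (Fin n) ℝ}
    (hA0 : ∀ i j, 0 ≤ A i j) (hA1 : ∀ i, ∑ j, A i j ≤ 1)
    (hfix : ∀ v : Fin n → ℝ, (∀ i, 0 ≤ v i) → A.mulVec v = v → v = 0) (u : Fin n → ℝ) :
    Tendsto (fun k => (A ^ k).mulVec u) atTop (nhds 0) := by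
  have hsucc : ∀ k, (A ^ (k + 1)).mulVec 1 = A.mulVec ((A ^ k).mulVec 1) := fun k => by
    rw [pow_succ', Matrix.mulVec_mulVec]
  have hrow : ∀ (M : Matrix (Fin n) (Fin n) ℝ) i, M.mulVec 1 i = ∑ j, M i j := fun M i => by
    simp [Matrix.mulVec, dotProduct]
  have hnonneg : ∀ k i, 0 ≤ (A ^ k).mulVec 1 i := fun k i => by
    rw [hrow]
    exact Finset.sum_nonneg fun j _ => Matrix.pow_apply_nonneg hA0 k i j
  have hanti : Antitone fun k => (A ^ k).mulVec 1 := by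
    refine antitone_nat_of_succ_le fun k i => ?_
    rw [pow_succ, ← Matrix.mulVec_mulVec]
    exact dotProduct_le_dotProduct_of_nonneg_left (fun j => (hrow A j).trans_le (hA1 j))
      (Matrix.pow_apply_nonneg hA0 k i)
  have hlim : Tendsto (fun k => (A ^ k).mulVec 1) atTop (nhds (⨅ k, (A ^ k).mulVec 1)) :=
    tendsto_atTop_ciInf hanti ⟨0, by rintro _ ⟨k, rfl⟩; exact hnonneg k⟩
  have hzero := hfix _ (fun i => ge_of_tendsto' ((tendsto_pi_nhds.1 hlim) i) fun k => hnonneg k i)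
    (tendsto_nhds_unique
      (((Continuous.matrix_mulVec continuous_const continuous_id).tendsto _).comp hlim)
      (((tendsto_add_atTop_iff_nat 1).2 hlim).congr hsucc))
  rw [hzero] at hlim
  have hentry : ∀ i j, Tendsto (fun k => (A ^ k) i j) atTop (nhds 0) := fun i j =>
    squeeze_zero (fun k => Matrix.pow_apply_nonneg hA0 k i j)
      (fun k => by
        rw [hrow]
        exact Finset.single_le_sum (fun l _ => Matrix.pow_apply_nonneg hA0 k i l)
          (Finset.mem_univ j))
      ((tendsto_pi_nhds.1 hlim) i)
  refine tendsto_pi_nhds.2 fun i => ?_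
  simpa [Matrix.mulVec, dotProduct] using
    tendsto_finsetSum Finset.univ fun j _ => (hentry i j).mul_const (u j)

/-- The deviation of the F-J iteration from a fixed point is propagated by the powers of `A`. -/
theorem fjSeq_sub_eq_pow_mulVec {n : ℕ} {A B : Matrix (Fin n) (Fin n) ℝ} {x0 y : Fin n → ℝ}
    (hy : A.mulVec y + B.mulVec x0 = y) (k : ℕ) :
    fjSeq A B x0 k - y = (A ^ k).mulVec (x0 - y) := by
  induction k with
  | zero => simp [fjSeq]
  | succ k ih =>
    rw [pow_succ', ← Matrix.mulVec_mulVec, ← ih, Matrix.mulVec_sub, fjSeq]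
    nth_rewrite 1 [← hy]
    abel

/-- Under Assumption 2, `I - ΞW` is invertible and the F-J iteration converges,
for every initial opinion `x0`, to `(I - ΞW)⁻¹ (I - Ξ) x0`. -/
theorem fj_limit_formula_of_assumption2
    (n : ℕ) (hn : 1 ≤ n)
    (W Ξ : Matrix (Fin n) (Fin n) ℝ) (ξ : Fin n → ℝ)
    (hW0 : ∀ i j, 0 ≤ W i j) (hW1 : ∀ i, ∑ j, W i j = 1)
    (hΞ : Ξ = Matrix.diagonal ξ) (hξ : ∀ i, 0 ≤ ξ i ∧ ξ i ≤ 1)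
    (hA2 : Assumption2 W ξ) :
    IsUnit (1 - Ξ * W) ∧
    ∀ x0 : Fin n → ℝ, ∀ i,
      Tendsto (fun k => fjSeq (Ξ * W) (1 - Ξ) x0 k i) atTop
        (nhds (((1 - Ξ * W)⁻¹ * (1 - Ξ)).mulVec x0 i)) := by
  have hA0 : ∀ i j, 0 ≤ (Ξ * W) i j := fun i j => by
    rw [hΞ, Matrix.diagonal_mul]
    exact mul_nonneg (hξ i).1 (hW0 i j)
  have hA1 : ∀ i, ∑ j, (Ξ * W) i j ≤ 1 := fun i => by
    simp_rw [hΞ, Matrix.diagonal_mul]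
    rw [← Finset.mul_sum, hW1, mul_one]
    exact (hξ i).2
  have hpow := tendsto_pow_mulVec_zero hA0 hA1 fun v hv0 hv =>
    eq_zero_of_diagonal_mul_mulVec_eq hW0 hW1 hξ hA2 hv0 (hΞ ▸ hv)
  have hunit : IsUnit (1 - Ξ * W) := by
    refine Matrix.mulVec_injective_iff_isUnit.1
      ((injective_iff_map_eq_zero (Matrix.mulVecLin (1 - Ξ * W))).2 fun u hu => ?_)
    rw [Matrix.mulVecLin_apply, Matrix.sub_mulVec, Matrix.one_mulVec, sub_eq_zero] at hu
    have hconst : ∀ k, ((Ξ * W) ^ k).mulVec u = u := fun k => by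
      induction k with
      | zero => simp
      | succ k ih => rw [pow_succ, ← Matrix.mulVec_mulVec, ← hu, ih]
    exact tendsto_nhds_unique (tendsto_const_nhds.congr fun k => (hconst k).symm) (hpow u)
  refine ⟨hunit, fun x0 => tendsto_pi_nhds.1 ?_⟩
  set y := ((1 - Ξ * W)⁻¹ * (1 - Ξ)).mulVec x0 with hy
  have hfix : (Ξ * W).mulVec y + (1 - Ξ).mulVec x0 = y := by
    have h : (1 - Ξ * W).mulVec y = (1 - Ξ).mulVec x0 := by
      rw [hy, Matrix.mulVec_mulVec,
        Matrix.mul_nonsing_inv_cancel_left _ _ ((Matrix.isUnit_iff_isUnit_det _).1 hunit)]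
    rw [← h, ← Matrix.add_mulVec, add_sub_cancel, Matrix.one_mulVec]
  exact tendsto_sub_nhds_zero_iff.1
    ((hpow (x0 - y)).congr fun k => (fjSeq_sub_eq_pow_mulVec hfix k).symm)
end

section
/- Corollary 1: Suppose there are no fully stubborn agents (ξᵢ > 0 for all i ∈ V) and Assumption 2 holds. Then the issue-sequence dynamics x(s+1) = Ψ·x(s) forms opinion clusters — i.e., for every x(0) ∈ ℝⁿ the limit lim_{s→∞} Ψ^s·x(0) exists, and for some x(0) ∈ ℝⁿ this limit is not of the form χ·1 for any χ ∈ ℝ — if and only if G(W) contains more than one ISCC (there exist two distinct ISCCs of G(W)). -/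
open Matrix Filter Finset

open Topology

/-- `S` contains every in-neighbour of its elements in the influence graph `G(W)`. -/
def InClosed {n : ℕ} (W : Matrix (Fin n) (Fin n) ℝ) (S : Set (Fin n)) : Prop :=
  ∀ i ∈ S, ∀ j, W i j ≠ 0 → j ∈ S

section Graph

variable {n : ℕ} {W : Matrix (Fin n) (Fin n) ℝ}

lemma InClosed.mem_of_pow_ne_zero {S : Set (Fin n)} (hS : InClosed W S) (m : ℕ) :
    ∀ i ∈ S, ∀ j, (W ^ m) i j ≠ 0 → j ∈ S := by
  induction m with
  | zero =>
    intro i hi j hj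
    by_contra hne
    have hij : i ≠ j := fun h => hne (h ▸ hi)
    exact hj (by simp [hij])
  | succ m ih =>
    intro i hi j hj
    rw [pow_succ, Matrix.mul_apply] at hj
    obtain ⟨k, -, hk⟩ := Finset.exists_ne_zero_of_sum_ne_zero hj
    exact hS k (ih i hi k (left_ne_zero_of_mul hk)) j (right_ne_zero_of_mul hk)

lemma pow_entry_nonneg (hW0 : ∀ i j, 0 ≤ W i j) (m : ℕ) (i j : Fin n) : 0 ≤ (W ^ m) i j := by
  induction m generalizing j with
  | zero => rw [pow_zero, Matrix.one_apply]; split_ifs <;> norm_num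
  | succ m ih =>
    rw [pow_succ, Matrix.mul_apply]
    exact Finset.sum_nonneg fun k _ => mul_nonneg (ih k) (hW0 k j)

lemma inClosed_reach (hW0 : ∀ i j, 0 ≤ W i j) (i : Fin n) :
    InClosed W {j | ∃ m, 0 < (W ^ m) i j} := by
  rintro k ⟨m, hm⟩ j hj
  refine ⟨m + 1, ?_⟩
  rw [pow_succ, Matrix.mul_apply]
  exact Finset.sum_pos' (fun l _ => mul_nonneg (pow_entry_nonneg hW0 m i l) (hW0 l j))
    ⟨k, Finset.mem_univ k, mul_pos hm (lt_of_le_of_ne (hW0 k j) hj.symm)⟩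

lemma InClosed.exists_isISCC_subset (hW0 : ∀ i j, 0 ≤ W i j) {A : Set (Fin n)}
    (hA : InClosed W A) (hne : A.Nonempty) : ∃ S ⊆ A, IsISCC W S := by
  obtain ⟨S, hSA, hS⟩ := (Set.toFinite {B : Set (Fin n) | InClosed W B ∧ B.Nonempty}
    ).exists_le_minimal (show A ∈ {B | InClosed W B ∧ B.Nonempty} from ⟨hA, hne⟩)
  refine ⟨S, hSA, hS.prop.2, hS.prop.1, fun i hi j hj hij => ?_⟩
  have hsub : {j | ∃ m, 0 < (W ^ m) i j} ⊆ S := by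
    rintro k ⟨m, hm⟩
    exact hS.prop.1.mem_of_pow_ne_zero m i hi k hm.ne'
  have hSR := hS.le_of_le
    (show {j | ∃ m, 0 < (W ^ m) i j} ∈ {B | InClosed W B ∧ B.Nonempty} from
      ⟨inClosed_reach hW0 i, i, 0, by simp⟩) hsub
  obtain ⟨m, hm⟩ := hSR hj
  refine ⟨m, Nat.one_le_iff_ne_zero.mpr ?_, hm⟩
  rintro rfl
  simp [hij] at hm

lemma IsISCC.subset_of_mem {S T : Set (Fin n)} (hS : IsISCC W S) (hT : InClosed W T)
    {k : Fin n} (hkS : k ∈ S) (hkT : k ∈ T) : S ⊆ T := by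
  intro j hj
  by_cases h : k = j
  · exact h ▸ hkT
  · obtain ⟨m, -, hm⟩ := hS.2.2 k hkS j hj h
    exact hT.mem_of_pow_ne_zero m k hkT j hm.ne'

lemma mulVec_le_of_le (hW0 : ∀ i j, 0 ≤ W i j) (hW1 : ∀ i, ∑ j, W i j = 1)
    {f : Fin n → ℝ} {d : ℝ} {i : Fin n} (hf : ∀ j, W i j ≠ 0 → f j ≤ d) :
    (W *ᵥ f) i ≤ d := by
  calc (W *ᵥ f) i = ∑ j, W i j * f j := rfl
    _ ≤ ∑ j, W i j * d := Finset.sum_le_sum fun j _ => by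
        by_cases h : W i j = 0
        · simp [h]
        · exact mul_le_mul_of_nonneg_left (hf j h) (hW0 i j)
    _ = d := by rw [← Finset.sum_mul, hW1, one_mul]

lemma eq_of_le_mulVec (hW0 : ∀ i j, 0 ≤ W i j) (hW1 : ∀ i, ∑ j, W i j = 1)
    {f : Fin n → ℝ} {d : ℝ} {i : Fin n} (hf : ∀ j, W i j ≠ 0 → f j ≤ d)
    (hd : d ≤ (W *ᵥ f) i) {j : Fin n} (hj : W i j ≠ 0) : f j = d := by
  refine le_antisymm (hf j hj) (not_lt.mp fun hlt => ?_)
  have : ∑ k, W i k * f k < ∑ k, W i k * d :=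
    Finset.sum_lt_sum (fun k _ => by
      by_cases h : W i k = 0
      · simp [h]
      · exact mul_le_mul_of_nonneg_left (hf k h) (hW0 i k))
      ⟨j, Finset.mem_univ j, mul_lt_mul_of_pos_left hlt (lt_of_le_of_ne (hW0 i j) hj.symm)⟩
  rw [← Finset.sum_mul, hW1, one_mul] at this
  exact absurd hd (not_le.mpr this)

lemma inClosed_max_of_harmonic (hW0 : ∀ i j, 0 ≤ W i j) (hW1 : ∀ i, ∑ j, W i j = 1)
    {f : Fin n → ℝ} (hf : W *ᵥ f = f) {d : ℝ} (hd : ∀ j, f j ≤ d) :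
    InClosed W {i | f i = d} := fun i hi _ hj =>
  eq_of_le_mulVec hW0 hW1 (fun k _ => hd k) (by rw [hf]; exact hi.ge) hj

lemma harmonic_const_of_isISCC_unique (hW0 : ∀ i j, 0 ≤ W i j) (hW1 : ∀ i, ∑ j, W i j = 1)
    (huniq : ∀ S T, IsISCC W S → IsISCC W T → S = T) {f : Fin n → ℝ} (hf : W *ᵥ f = f) :
    ∃ c, f = fun _ => c := by
  rcases isEmpty_or_nonempty (Fin n) with h | h
  · exact ⟨0, Subsingleton.elim _ _⟩
  obtain ⟨a, ha⟩ := Finite.exists_max f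
  obtain ⟨b, hb⟩ := Finite.exists_min f
  obtain ⟨S, hSA, hS⟩ := (inClosed_max_of_harmonic hW0 hW1 hf ha).exists_isISCC_subset hW0 ⟨a, rfl⟩
  obtain ⟨T, hTB, hT⟩ := (inClosed_max_of_harmonic hW0 hW1 (f := -f) (d := -f b)
    (by rw [Matrix.mulVec_neg, hf]) (fun j => neg_le_neg (hb j))).exists_isISCC_subset hW0 ⟨b, rfl⟩
  obtain ⟨k, hk⟩ := hS.1
  have h1 : f k = f a := hSA hk
  have h2 : -f k = -f b := hTB (huniq S T hS hT ▸ hk)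
  refine ⟨f a, funext fun i => le_antisymm (ha i) ?_⟩
  linarith [hb i]

end Graph

/-- A linear contraction of a finite-dimensional space has convergent orbits as soon as
increments of orbits cannot keep a constant positive norm. -/
lemma LinearMap.exists_tendsto_pow_of_contraction {E : Type*} [NormedAddCommGroup E]
    [NormedSpace ℝ E] [FiniteDimensional ℝ E] (T : E →ₗ[ℝ] E) (hT : ∀ x, ‖T x‖ ≤ ‖x‖)
    (h : ∀ z d, (∀ m, ‖(T ^ m) (T z - z)‖ = d) → d = 0) (x : E) :
    ∃ L, Tendsto (fun s => (T ^ s) x) atTop (𝓝 L) := by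
  have hle : ∀ m y, ‖(T ^ m) y‖ ≤ ‖y‖ := by
    intro m
    induction m with
    | zero => simp
    | succ m ih => intro y; rw [pow_succ]; exact (ih (T y)).trans (hT y)
  have hcont : ∀ m : ℕ, Continuous ⇑(T ^ m) := fun m => (T ^ m).continuous_of_finiteDimensional
  have hrange : ∀ y, Tendsto (fun s => (T ^ s) (T y - y)) atTop (𝓝 0) := by
    intro y
    have hanti : Antitone fun s => ‖(T ^ s) (T y - y)‖ :=
      antitone_nat_of_succ_le fun s => by rw [pow_succ']; exact hT _
    obtain ⟨d, hd⟩ : ∃ d, Tendsto (fun s => ‖(T ^ s) (T y - y)‖) atTop (𝓝 d) :=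
      ⟨_, tendsto_atTop_ciInf hanti ⟨0, by rintro _ ⟨s, rfl⟩; exact norm_nonneg _⟩⟩
    have : ProperSpace E := FiniteDimensional.proper ℝ E
    obtain ⟨z, -, φ, hφ, hz⟩ := (isCompact_closedBall (0 : E) ‖y‖).tendsto_subseq
      (x := fun s => (T ^ s) y) (fun s => by simpa using hle s y)
    have hd0 : d = 0 := h z d fun m => by
      have h1 : Tendsto (fun k => ‖(T ^ m) (T ((T ^ φ k) y) - (T ^ φ k) y)‖) atTop
          (𝓝 ‖(T ^ m) (T z - z)‖) :=
        ((((hcont m).comp ((T.continuous_of_finiteDimensional).sub continuous_id)).norm).tendsto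
          z).comp hz
      have h2 : Tendsto (fun k => ‖(T ^ (m + φ k)) (T y - y)‖) atTop (𝓝 d) :=
        hd.comp (tendsto_atTop_mono (fun k => Nat.le_add_left (φ k) m) hφ.tendsto_atTop)
      refine tendsto_nhds_unique h1 (h2.congr fun k => ?_)
      have hcomm : T ((T ^ φ k) y) = (T ^ φ k) (T y) := by
        rw [← Module.End.mul_apply, ← Module.End.mul_apply, ← pow_succ, ← pow_succ']
      rw [pow_add, Module.End.mul_apply, map_sub (T ^ φ k), hcomm]
    rw [hd0] at hd
    exact tendsto_zero_iff_norm_tendsto_zero.mpr hd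
  have hfix : ∀ u ∈ LinearMap.ker (T - 1), ∀ s, (T ^ s) u = u := by
    intro u hu s
    have hu' : T u = u := by simpa [sub_eq_zero] using hu
    induction s with
    | zero => simp
    | succ s ih => rw [pow_succ, Module.End.mul_apply, hu', ih]
  have hdisj : Disjoint (LinearMap.ker (T - 1)) (LinearMap.range (T - 1)) := by
    rw [Submodule.disjoint_def]
    rintro u hu ⟨y, rfl⟩
    have h1 := hrange y
    have h2 : (fun s => (T ^ s) (T y - y)) = fun _ => T y - y := funext fun s => hfix _ hu s
    rw [h2] at h1
    exact tendsto_nhds_unique tendsto_const_nhds h1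
  have hsup : LinearMap.ker (T - 1) ⊔ LinearMap.range (T - 1) = ⊤ := by
    apply Submodule.eq_top_of_disjoint _ _ _ hdisj
    rw [add_comm, LinearMap.finrank_range_add_finrank_ker]
  obtain ⟨u, hu, e, ⟨y, rfl⟩, rfl⟩ :=
    Submodule.mem_sup.mp (hsup ▸ Submodule.mem_top : x ∈ LinearMap.ker (T - 1) ⊔ _)
  refine ⟨u, ?_⟩
  have := (hrange y).const_add u
  rw [add_zero] at this
  refine this.congr fun s => ?_
  rw [map_add, hfix u hu]
  rfl

section Dynamics

variable {n : ℕ} {W : Matrix (Fin n) (Fin n) ℝ} {ξ : Fin n → ℝ}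

/-- Maximum principle on an in-closed set. -/
lemma InClosed.le_of_le_mulVec (hW0 : ∀ i j, 0 ≤ W i j) (hW1 : ∀ i, ∑ j, W i j = 1)
    (hξ : ∀ i, 0 ≤ ξ i ∧ ξ i ≤ 1) (hA2 : Assumption2 W ξ) {S : Set (Fin n)}
    (hS : InClosed W S) {g : Fin n → ℝ} {c : ℝ}
    (hg : ∀ i ∈ S, g i ≤ ξ i * (W *ᵥ g) i + (1 - ξ i) * c) : ∀ i ∈ S, g i ≤ c := by
  intro k hk
  obtain ⟨a, haS, ha⟩ := S.toFinite.exists_maximalFor g S ⟨k, hk⟩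
  have hmax : ∀ i ∈ S, g i ≤ g a := fun i hi => (le_total (g i) (g a)).elim id (ha hi)
  refine (hmax k hk).trans (not_lt.mp fun hlt => ?_)
  have hnbr : ∀ i ∈ S, ∀ j, W i j ≠ 0 → g j ≤ g a := fun i hi j hj => hmax j (hS i hi j hj)
  have hone : ∀ i ∈ S, g i = g a → ξ i = 1 := by
    intro i hi hia
    have h1 := hg i hi
    have h2 := mul_le_mul_of_nonneg_left (mulVec_le_of_le hW0 hW1 (hnbr i hi)) (hξ i).1
    have h3 := (hξ i).2
    by_contra hne
    have : 0 < (1 - ξ i) * (g a - c) :=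
      mul_pos (sub_pos.mpr (lt_of_le_of_ne h3 hne)) (sub_pos.mpr hlt)
    nlinarith
  have hA : InClosed W {i | i ∈ S ∧ g i = g a} := by
    rintro i ⟨hi, hia⟩ j hj
    refine ⟨hS i hi j hj, eq_of_le_mulVec hW0 hW1 (hnbr i hi) ?_ hj⟩
    have h1 := hg i hi
    rw [hone i hi hia] at h1
    linarith
  obtain ⟨B, hBA, hB⟩ := hA.exists_isISCC_subset hW0 ⟨a, haS, rfl⟩
  obtain ⟨i, hiB, hi⟩ := hA2 B hB
  exact hi.ne (hone i (hBA hiB).1 (hBA hiB).2)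

lemma InClosed.eq_of_eq_mulVec (hW0 : ∀ i j, 0 ≤ W i j) (hW1 : ∀ i, ∑ j, W i j = 1)
    (hξ : ∀ i, 0 ≤ ξ i ∧ ξ i ≤ 1) (hA2 : Assumption2 W ξ) {S : Set (Fin n)}
    (hS : InClosed W S) {g : Fin n → ℝ} {c : ℝ}
    (hg : ∀ i ∈ S, g i = ξ i * (W *ᵥ g) i + (1 - ξ i) * c) : ∀ i ∈ S, g i = c := by
  intro i hi
  refine le_antisymm (hS.le_of_le_mulVec hW0 hW1 hξ hA2 (fun j hj => (hg j hj).le) i hi) ?_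
  have := hS.le_of_le_mulVec hW0 hW1 hξ hA2 (g := -g) (c := -c) (fun j hj => by
    rw [Matrix.mulVec_neg, Pi.neg_apply, Pi.neg_apply, hg j hj]
    linarith) i hi
  exact neg_le_neg_iff.mp this

lemma one_sub_diagonal_mul_mulVec (y : Fin n → ℝ) (i : Fin n) :
    ((1 - Matrix.diagonal ξ * W) *ᵥ y) i = y i - ξ i * (W *ᵥ y) i := by
  rw [Matrix.sub_mulVec, Matrix.one_mulVec, ← Matrix.mulVec_mulVec, Pi.sub_apply,
    Matrix.mulVec_diagonal]

lemma isUnit_det_one_sub_diagonal_mul (hW0 : ∀ i j, 0 ≤ W i j) (hW1 : ∀ i, ∑ j, W i j = 1)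
    (hξ : ∀ i, 0 ≤ ξ i ∧ ξ i ≤ 1) (hA2 : Assumption2 W ξ) :
    IsUnit (1 - Matrix.diagonal ξ * W).det := by
  rw [isUnit_iff_ne_zero]
  intro h0
  obtain ⟨v, hv, hv0⟩ := Matrix.exists_mulVec_eq_zero_iff.mpr h0
  refine hv (funext fun i => ?_)
  have huniv : InClosed W Set.univ := fun _ _ _ _ => Set.mem_univ _
  refine huniv.eq_of_eq_mulVec hW0 hW1 hξ hA2 (c := 0) (fun j _ => ?_) i (Set.mem_univ i)
  have := congrFun hv0 j
  rw [one_sub_diagonal_mul_mulVec, Pi.zero_apply] at this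
  linarith

/-- The implicit form of one step of the issue-sequence dynamics. -/
lemma issue_step (hW0 : ∀ i j, 0 ≤ W i j) (hW1 : ∀ i, ∑ j, W i j = 1)
    (hξ : ∀ i, 0 ≤ ξ i ∧ ξ i ≤ 1) (hA2 : Assumption2 W ξ) (x : Fin n → ℝ) (i : Fin n) :
    let y := ((1 - Matrix.diagonal ξ * W)⁻¹ * (1 - Matrix.diagonal ξ)) *ᵥ x
    y i = ξ i * (W *ᵥ y) i + (1 - ξ i) * x i := by
  intro y
  have h : (1 - Matrix.diagonal ξ * W) *ᵥ y = (1 - Matrix.diagonal ξ) *ᵥ x := by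
    rw [Matrix.mulVec_mulVec, ← Matrix.mul_assoc,
      Matrix.mul_nonsing_inv _ (isUnit_det_one_sub_diagonal_mul hW0 hW1 hξ hA2), Matrix.one_mul]
  have hi := congrFun h i
  rw [one_sub_diagonal_mul_mulVec, Matrix.sub_mulVec, Matrix.one_mulVec, Pi.sub_apply,
    Matrix.mulVec_diagonal] at hi
  linarith

lemma abs_mulVec_le (hW0 : ∀ i j, 0 ≤ W i j) (y : Fin n → ℝ) (i : Fin n) :
    |(W *ᵥ y) i| ≤ (W *ᵥ fun j => |y j|) i := by
  change |∑ j, W i j * y j| ≤ ∑ j, W i j * |y j|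
  refine (Finset.abs_sum_le_sum_abs _ _).trans (Finset.sum_le_sum fun j _ => ?_)
  rw [abs_mul, abs_of_nonneg (hW0 i j)]

lemma abs_step_le (hW0 : ∀ i j, 0 ≤ W i j) (hξ : ∀ i, 0 ≤ ξ i ∧ ξ i ≤ 1)
    {x y : Fin n → ℝ} (hxy : ∀ i, y i = ξ i * (W *ᵥ y) i + (1 - ξ i) * x i) (i : Fin n) :
    |y i| ≤ ξ i * (W *ᵥ fun j => |y j|) i + (1 - ξ i) * ‖x‖ := by
  calc |y i| = |ξ i * (W *ᵥ y) i + (1 - ξ i) * x i| := by rw [← hxy i]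
    _ ≤ |ξ i * (W *ᵥ y) i| + |(1 - ξ i) * x i| := abs_add_le _ _
    _ = ξ i * |(W *ᵥ y) i| + (1 - ξ i) * |x i| := by
        rw [abs_mul, abs_mul, abs_of_nonneg (hξ i).1, abs_of_nonneg (sub_nonneg.mpr (hξ i).2)]
    _ ≤ _ := add_le_add
        (mul_le_mul_of_nonneg_left (abs_mulVec_le hW0 y i) (hξ i).1)
        (mul_le_mul_of_nonneg_left (norm_le_pi_norm x i) (sub_nonneg.mpr (hξ i).2))

lemma norm_step_le (hW0 : ∀ i j, 0 ≤ W i j) (hW1 : ∀ i, ∑ j, W i j = 1)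
    (hξ : ∀ i, 0 ≤ ξ i ∧ ξ i ≤ 1) (hA2 : Assumption2 W ξ)
    {x y : Fin n → ℝ} (hxy : ∀ i, y i = ξ i * (W *ᵥ y) i + (1 - ξ i) * x i) : ‖y‖ ≤ ‖x‖ := by
  have huniv : InClosed W Set.univ := fun _ _ _ _ => Set.mem_univ _
  exact (pi_norm_le_iff_of_nonneg (norm_nonneg x)).mpr fun i =>
    huniv.le_of_le_mulVec hW0 hW1 hξ hA2 (g := fun j => |y j|)
      (fun j _ => abs_step_le hW0 hξ hxy j) i (Set.mem_univ i)

/-- If a step preserves the norm, some stubborn agent attains it. -/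
lemma exists_stubborn_of_norm_step_eq (hn : 1 ≤ n) (hW0 : ∀ i j, 0 ≤ W i j)
    (hW1 : ∀ i, ∑ j, W i j = 1) (hξ : ∀ i, 0 ≤ ξ i ∧ ξ i ≤ 1) (hVf : ∀ i, 0 < ξ i)
    (hA2 : Assumption2 W ξ) {x y : Fin n → ℝ}
    (hxy : ∀ i, y i = ξ i * (W *ᵥ y) i + (1 - ξ i) * x i) (h : ‖y‖ = ‖x‖) :
    ∃ i, ξ i < 1 ∧ |y i| = ‖y‖ := by
  have : Nonempty (Fin n) := ⟨⟨0, hn⟩⟩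
  obtain ⟨a, ha⟩ := Finite.exists_max fun i => |y i|
  have hya : |y a| = ‖y‖ := le_antisymm (norm_le_pi_norm y a)
    ((pi_norm_le_iff_of_nonneg (abs_nonneg _)).mpr ha)
  have hA : InClosed W {i | |y i| = ‖y‖} := by
    intro i hi j hj
    refine eq_of_le_mulVec hW0 hW1 (f := fun j => |y j|) (fun k _ => norm_le_pi_norm y k) ?_ hj
    have h1 := abs_step_le hW0 hξ hxy i
    rw [show |y i| = ‖y‖ from hi, ← h] at h1
    exact le_of_mul_le_mul_left (by linarith) (hVf i)
  obtain ⟨S, hSA, hS⟩ := hA.exists_isISCC_subset hW0 ⟨a, hya⟩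
  obtain ⟨i, hiS, hi⟩ := hA2 S hS
  exact ⟨i, hi, hSA hiS⟩

/-- A stubborn agent attaining the norm after a norm-preserving step has not moved. -/
lemma eq_of_norm_step_eq (hW0 : ∀ i j, 0 ≤ W i j)
    (hW1 : ∀ i, ∑ j, W i j = 1) (hξ : ∀ i, 0 ≤ ξ i ∧ ξ i ≤ 1) {x y : Fin n → ℝ}
    (hxy : ∀ i, y i = ξ i * (W *ᵥ y) i + (1 - ξ i) * x i) (h : ‖y‖ = ‖x‖)
    {i : Fin n} (hi : ξ i < 1) (hyi : |y i| = ‖y‖) : x i = y i := by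
  have hw : |(W *ᵥ y) i| ≤ ‖y‖ := (abs_mulVec_le hW0 y i).trans
    (mulVec_le_of_le hW0 hW1 fun j _ => norm_le_pi_norm y j)
  have hx : |x i| ≤ ‖y‖ := h ▸ norm_le_pi_norm x i
  have hi' : 0 < 1 - ξ i := sub_pos.mpr hi
  have hxyi := hxy i
  rw [abs_le] at hw hx
  have h1 := mul_le_mul_of_nonneg_left hw.1 (hξ i).1
  have h2 := mul_le_mul_of_nonneg_left hw.2 (hξ i).1
  rcases abs_choice (y i) with hs | hs <;> rw [hs] at hyi
  · have : ‖y‖ ≤ x i := le_of_mul_le_mul_left (a := 1 - ξ i) (by linarith) hi'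
    linarith
  · have : x i ≤ -‖y‖ := le_of_mul_le_mul_left (a := 1 - ξ i) (by linarith) hi'
    linarith

lemma norm_increment_eq_zero (hn : 1 ≤ n) (hW0 : ∀ i j, 0 ≤ W i j)
    (hW1 : ∀ i, ∑ j, W i j = 1) (hξ : ∀ i, 0 ≤ ξ i ∧ ξ i ≤ 1) (hVf : ∀ i, 0 < ξ i)
    (hA2 : Assumption2 W ξ) {T : (Fin n → ℝ) →ₗ[ℝ] (Fin n → ℝ)}
    (hT : ∀ x i, T x i = ξ i * (W *ᵥ T x) i + (1 - ξ i) * x i) (z : Fin n → ℝ) (d : ℝ)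
    (hd : ∀ m, ‖(T ^ m) (T z - z)‖ = d) : d = 0 := by
  set e : ℕ → Fin n → ℝ := fun m => (T ^ m) (T z - z) with he
  have hstep : ∀ m i, e (m + 1) i = ξ i * (W *ᵥ e (m + 1)) i + (1 - ξ i) * e m i := by
    intro m i
    simp only [he, pow_succ']
    exact hT _ i
  have hnorm : ∀ m, ‖e (m + 1)‖ = ‖e m‖ := fun m => (hd _).trans (hd _).symm
  choose a ha1 ha2 using fun m =>
    exists_stubborn_of_norm_step_eq hn hW0 hW1 hξ hVf hA2 (hstep m) (hnorm m)
  obtain ⟨i, hi⟩ := Finite.exists_infinite_fiber a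
  have hinf : (a ⁻¹' {i}).Infinite := Set.infinite_coe_iff.mp hi
  have hξi : ξ i < 1 := by
    obtain ⟨m, hm⟩ := hinf.nonempty
    exact (show a m = i from hm) ▸ ha1 m
  have hback : ∀ k m, |e (m + k) i| = d → |e m i| = d := by
    intro k
    induction k with
    | zero => exact fun m h => h
    | succ k ih =>
      intro m h
      refine ih m ?_
      rw [eq_of_norm_step_eq hW0 hW1 hξ (hstep (m + k)) (hnorm _) hξi (h.trans (hd _).symm)]
      exact h
  have habs : ∀ m, |e m i| = d := by
    intro m
    obtain ⟨k, hk, hmk⟩ := hinf.exists_gt m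
    have h1 : |e (k + 1) i| = d := by
      rw [← (show a k = i from hk)]
      exact (ha2 k).trans (hd _)
    refine hback (k + 1 - m) m ?_
    rwa [Nat.add_sub_cancel' (by omega)]
  have hconst : ∀ m, e m i = e 0 i := by
    intro m
    induction m with
    | zero => rfl
    | succ m ih =>
      rw [← ih]
      exact (eq_of_norm_step_eq hW0 hW1 hξ (hstep m) (hnorm m) hξi
        ((habs _).trans (hd _).symm)).symm
  have hsum : ∀ m : ℕ, (T ^ m) z i = z i + m * e 0 i := by
    intro m
    induction m with
    | zero => simp
    | succ m ih =>
      have h1 : (T ^ (m + 1)) z - (T ^ m) z = e m := by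
        simp only [he, map_sub, pow_succ, Module.End.mul_apply]
      have h2 := congrFun h1 i
      rw [Pi.sub_apply, hconst m, ih] at h2
      push_cast
      linarith
  have hbdd : ∀ m, ‖(T ^ m) z‖ ≤ ‖z‖ := by
    intro m
    induction m with
    | zero => simp
    | succ m ih =>
      rw [pow_succ']
      exact (norm_step_le hW0 hW1 hξ hA2 (hT _)).trans ih
  have hd0 : 0 ≤ d := hd 0 ▸ norm_nonneg _
  by_contra hne
  obtain ⟨m, hm⟩ := exists_nat_gt (2 * ‖z‖ / d)
  rw [div_lt_iff₀ (lt_of_le_of_ne hd0 (Ne.symm hne))] at hm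
  have h1 : |(T ^ m) z i| ≤ ‖z‖ := (norm_le_pi_norm _ i).trans (hbdd m)
  have h2 : |z i| ≤ ‖z‖ := norm_le_pi_norm z i
  have h3 : (m : ℝ) * d = |(T ^ m) z i - z i| := by
    rw [hsum m, add_sub_cancel_left, abs_mul, habs 0, Nat.abs_cast]
  have h4 := abs_sub ((T ^ m) z i) (z i)
  linarith

end Dynamics

/-- Corollary 1: with no fully stubborn agents and Assumption 2, the issue-sequence
dynamics `x(s+1) = Ψ x(s)` forms opinion clusters (limits always exist, but consensus
fails for some initial opinion) iff `G(W)` has more than one ISCC. -/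
theorem issue_sequence_clusters_iff
    (n : ℕ) (hn : 1 ≤ n)
    (W Ξ : Matrix (Fin n) (Fin n) ℝ) (ξ : Fin n → ℝ)
    (hW0 : ∀ i j, 0 ≤ W i j) (hW1 : ∀ i, ∑ j, W i j = 1)
    (hΞ : Ξ = Matrix.diagonal ξ) (hξ : ∀ i, 0 ≤ ξ i ∧ ξ i ≤ 1)
    (hVf : ∀ i, 0 < ξ i)
    (hA2 : Assumption2 W ξ)
    (Ψ : Matrix (Fin n) (Fin n) ℝ) (hΨ : Ψ = (1 - Ξ * W)⁻¹ * (1 - Ξ)) :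
    ((∀ x0 : Fin n → ℝ, ∃ L : Fin n → ℝ, ∀ l,
        Tendsto (fun s => (Ψ ^ s).mulVec x0 l) atTop (nhds (L l))) ∧
      (∃ x0 : Fin n → ℝ, ∃ L : Fin n → ℝ,
        (∀ l, Tendsto (fun s => (Ψ ^ s).mulVec x0 l) atTop (nhds (L l))) ∧
        ∀ χ : ℝ, L ≠ fun _ => χ))
    ↔ (∃ S T : Set (Fin n), IsISCC W S ∧ IsISCC W T ∧ S ≠ T) := by
  subst hΞ
  set T : (Fin n → ℝ) →ₗ[ℝ] (Fin n → ℝ) := Matrix.toLin' Ψ with hTdef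
  have hpow : ∀ s x, (Ψ ^ s).mulVec x = (T ^ s) x := fun s x => by
    rw [hTdef, ← Matrix.toLin'_pow, Matrix.toLin'_apply]
  have hT : ∀ x i, T x i = ξ i * (W *ᵥ T x) i + (1 - ξ i) * x i := fun x i => by
    rw [hTdef, Matrix.toLin'_apply, hΨ]
    exact issue_step hW0 hW1 hξ hA2 x i
  have hlim : ∀ x, ∃ L, Tendsto (fun s => (T ^ s) x) atTop (𝓝 L) :=
    T.exists_tendsto_pow_of_contraction (fun x => norm_step_le hW0 hW1 hξ hA2 (hT x))
      (norm_increment_eq_zero hn hW0 hW1 hξ hVf hA2 hT)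
  simp only [hpow]
  constructor
  · rintro ⟨-, x, L, hL, hne⟩
    by_contra! huniq
    have hL' : Tendsto (fun s => (T ^ s) x) atTop (𝓝 L) := tendsto_pi_nhds.mpr hL
    have hfix : T L = L := by
      refine tendsto_nhds_unique ((T.continuous_of_finiteDimensional.tendsto L).comp hL') ?_
      refine (hL'.comp (tendsto_add_atTop_nat 1)).congr fun s => ?_
      simp only [Function.comp_apply, pow_succ', Module.End.mul_apply]
    have hWL : W *ᵥ L = L := funext fun i => by
      have h := hT L i
      rw [hfix] at h
      exact mul_left_cancel₀ (hVf i).ne' (by linarith)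
    obtain ⟨c, hc⟩ := harmonic_const_of_isISCC_unique hW0 hW1 huniq hWL
    exact hne c hc
  · rintro ⟨S, U, hS, hU, hSU⟩
    refine ⟨fun x => (hlim x).imp fun L hL => tendsto_pi_nhds.mp hL, ?_⟩
    have hdisj : ∀ k ∈ U, k ∉ S := fun k hkU hkS => hSU
      ((hS.subset_of_mem hU.2.1 hkS hkU).antisymm (hU.subset_of_mem hS.2.1 hkU hkS))
    have hconst : ∀ {A : Set (Fin n)} {x : Fin n → ℝ} {c : ℝ}, InClosed W A →
        (∀ i ∈ A, x i = c) → ∀ s, ∀ i ∈ A, (T ^ s) x i = c := by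
      intro A x c hA hx s
      induction s with
      | zero => exact hx
      | succ s ih =>
        rw [pow_succ']
        refine hA.eq_of_eq_mulVec hW0 hW1 hξ hA2 fun i hi => ?_
        rw [← ih i hi]
        exact hT _ i
    obtain ⟨L, hL⟩ := hlim (S.indicator 1)
    rw [tendsto_pi_nhds] at hL
    refine ⟨S.indicator 1, L, hL, fun χ hχ => ?_⟩
    obtain ⟨a, ha⟩ := hS.1
    obtain ⟨b, hb⟩ := hU.1
    have hLa : L a = 1 := tendsto_nhds_unique (hL a) (tendsto_const_nhds.congr fun s =>
      (hconst hS.2.1 (fun i hi => Set.indicator_of_mem hi 1) s a ha).symm)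
    have hLb : L b = 0 := tendsto_nhds_unique (hL b) (tendsto_const_nhds.congr fun s =>
      (hconst hU.2.1 (fun i hi => Set.indicator_of_notMem (hdisj i hi) 1) s b hb).symm)
    rw [hχ] at hLa hLb
    exact one_ne_zero (hLa.symm.trans hLb)
end
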